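/- arXiv:2003.03854 — 4 statements merged into one kernel-verified Lean document; each statement's English description precedes it below -/
import Mathlib

section
/- For a smooth vector field X on D the following are equivalent: (i) X(h) vanishes at every point of M for every smooth function h : D → ℝ; (ii) X(x) = 0 for every x ∈ M; (iii) there exist smooth vector fields Y_1, …, Y_k on D with X = Σ_{a=1}^k f^a Y_a (componentwise, X^i = Σ_a f^a Y_a^i on D). -/
open scoped BigOperators

noncomputable section

/-- `∂ᵢ h`, the `i`-th partial derivative of `h : ℝⁿ → ℝ`. -/
def pd {n : ℕ} (h : (Fin n → ℝ) → ℝ) (i : Fin n) (x : Fin n → ℝ) : ℝ :=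
  fderiv ℝ h x (Pi.single i 1)

/-- The action `X(h) = Σᵢ Xⁱ ∂ᵢ h` of a vector field on a function. -/
def vact {n : ℕ} (X : (Fin n → ℝ) → Fin n → ℝ) (h : (Fin n → ℝ) → ℝ)
    (x : Fin n → ℝ) : ℝ :=
  ∑ i, X x i * pd h i x

/-- The Lie bracket `[X,Y]ʲ = Σᵢ (Xⁱ ∂ᵢYʲ − Yⁱ ∂ᵢXʲ)` of vector fields. -/
def lie {n : ℕ} (X Y : (Fin n → ℝ) → Fin n → ℝ) (x : Fin n → ℝ) : Fin n → ℝ :=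
  fun j => ∑ i, (X x i * pd (fun y => Y y j) i x - Y x i * pd (fun y => X y j) i x)

open Set Filter Topology MeasureTheory in
theorem aux_param {H : Type} [NormedAddCommGroup H] [NormedSpace ℝ H] [FiniteDimensional ℝ H]
    (m : ℕ) : ∀ {E : Type} [NormedAddCommGroup E] [NormedSpace ℝ E] [CompleteSpace E]
    (G : H × ℝ → E), ContDiff ℝ m G → ContDiff ℝ m (fun x => ∫ s in (0:ℝ)..1, G (x, s)) := by
  have key : ∀ {E : Type} [NormedAddCommGroup E] [NormedSpace ℝ E] [CompleteSpace E]
    (G : H × ℝ → E), Continuous G → Continuous (fun x => ∫ s in (0:ℝ)..1, G (x, s)) := by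
    intro E _ _ _ G hG
    exact intervalIntegral.continuous_parametric_intervalIntegral_of_continuous'
      (f := fun x s => G (x, s)) hG 0 1
  induction m with
  | zero =>
    intro E _ _ _ G hG
    simp only [CharP.cast_eq_zero, contDiff_zero] at hG ⊢
    exact key G hG
  | succ m ih =>
    intro E _ _ _ G hG
    have hGd : Differentiable ℝ G := hG.differentiable (by simp)
    let G' : H × ℝ → (H →L[ℝ] E) := fun p => (fderiv ℝ G p).comp (ContinuousLinearMap.inl ℝ H ℝ)
    have hG' : ContDiff ℝ m G' := by
      have h1 : ContDiff ℝ m (fderiv ℝ G) := hG.fderiv_right (by norm_cast)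
      exact h1.clm_comp contDiff_const
    have hd : ∀ (s : ℝ) (x : H), HasFDerivAt (fun x => G (x, s)) (G' (x, s)) x := by
      intro s x
      exact (hGd (x, s)).hasFDerivAt.comp x (hasFDerivAt_prodMk_left x s)
    have hGs : ∀ x, Continuous fun s => G (x, s) := fun x => hG.continuous.comp (by fun_prop)
    have hGs' : ∀ x, Continuous fun s => G' (x, s) := fun x => hG'.continuous.comp (by fun_prop)
    push_cast
    rw [contDiff_succ_iff_hasFDerivAt]
    refine ⟨fun x => ∫ s in (0:ℝ)..1, G' (x, s), ih G' hG', fun x => ?_⟩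
    have hc : IsCompact (Metric.closedBall x 1 ×ˢ Icc (0:ℝ) 1) :=
      (isCompact_closedBall x 1).prod isCompact_Icc
    obtain ⟨C, hC⟩ := hc.exists_bound_of_continuousOn (hG'.continuous.continuousOn)
    refine intervalIntegral.hasFDerivAt_integral_of_dominated_of_fderiv_le
      (F := fun x s => G (x, s)) (F' := fun x s => G' (x, s)) (bound := fun _ => C)
      (Metric.closedBall_mem_nhds x one_pos) ?_ ?_ ?_ ?_ ?_ ?_
    · exact Eventually.of_forall fun y => (hGs y).aestronglyMeasurable
    · exact (hGs x).intervalIntegrable _ _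
    · exact (hGs' x).aestronglyMeasurable
    · refine Eventually.of_forall fun s hs y hy => hC (y, s) ⟨hy, ?_⟩
      rw [uIoc_of_le zero_le_one] at hs
      exact ⟨hs.1.le, hs.2⟩
    · simp
    · exact Eventually.of_forall fun s _ y _ => hd s y

open Set Filter Topology MeasureTheory in
theorem aux_hadamard {E F G : Type} [NormedAddCommGroup E] [NormedSpace ℝ E] [FiniteDimensional ℝ E]
    [NormedAddCommGroup F] [NormedSpace ℝ F] [FiniteDimensional ℝ F]
    [NormedAddCommGroup G] [NormedSpace ℝ G] [CompleteSpace G]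
    (g : E × F → G) (hg : ContDiff ℝ (⊤ : ℕ∞) g) (h0 : ∀ w, g (0, w) = 0) :
    ∃ H : E × F → (E →L[ℝ] G), ContDiff ℝ (⊤ : ℕ∞) H ∧ ∀ p, g p = H p p.1 := by
  let K : (E × F) × ℝ → (E →L[ℝ] G) := fun q =>
    (fderiv ℝ g (q.2 • q.1.1, q.1.2)).comp (ContinuousLinearMap.inl ℝ E F)
  have hK : ContDiff ℝ (⊤ : ℕ∞) K := by
    have h1 : ContDiff ℝ (⊤ : ℕ∞) (fderiv ℝ g) := hg.fderiv_right (by simp)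
    refine ContDiff.clm_comp (h1.comp ?_) contDiff_const
    fun_prop
  refine ⟨fun p => ∫ s in (0:ℝ)..1, K (p, s), ?_, fun p => ?_⟩
  · rw [contDiff_infty]
    intro m
    exact aux_param m K (hK.of_le (by exact_mod_cast le_top))
  · have hKc : Continuous fun s => K (p, s) := hK.continuous.comp (by fun_prop)
    rw [ContinuousLinearMap.intervalIntegral_apply (hKc.intervalIntegrable _ _)]
    have hd : ∀ s : ℝ, HasDerivAt (fun s : ℝ => g (s • p.1, p.2)) (K (p, s) p.1) s := by
      intro s
      have h1 : HasDerivAt (fun s : ℝ => (s • p.1, p.2)) (p.1, (0:F)) s := by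
        refine HasDerivAt.prodMk ?_ (hasDerivAt_const s p.2)
        simpa using (hasDerivAt_id s).smul_const p.1
      exact ((hg.differentiable (by simp) (s • p.1, p.2)).hasFDerivAt).comp_hasDerivAt s h1
    rw [intervalIntegral.integral_eq_sub_of_hasDerivAt (fun s _ => hd s)
      ((hKc.clm_apply continuous_const).intervalIntegrable _ _)]
    simp [h0]

open Set Filter Topology MeasureTheory in
theorem aux_local {E F G : Type} [NormedAddCommGroup E] [NormedSpace ℝ E] [FiniteDimensional ℝ E]
    [NormedAddCommGroup F] [NormedSpace ℝ F] [FiniteDimensional ℝ F]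
    [NormedAddCommGroup G] [NormedSpace ℝ G] [CompleteSpace G]
    (D : Set E) (hD : IsOpen D) (f : E → F) (hf : ContDiffOn ℝ (⊤ : ℕ∞) f D)
    (X : E → G) (hX : ContDiffOn ℝ (⊤ : ℕ∞) X D) (h0 : ∀ x ∈ D, f x = 0 → X x = 0)
    (x₀ : E) (hx₀ : x₀ ∈ D) (hs : Function.Surjective (fderiv ℝ f x₀)) :
    ∃ U ∈ 𝓝 x₀, ∃ A : E → (F →L[ℝ] G), ContDiffOn ℝ (⊤ : ℕ∞) A U ∧
      ∀ x ∈ U, X x = A x (f x) := by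
  have : CompleteSpace E := FiniteDimensional.complete ℝ E
  have : CompleteSpace F := FiniteDimensional.complete ℝ F
  obtain ⟨P, hP⟩ :=
    (fderiv ℝ f x₀).ker_closedComplemented_of_finiteDimensional_range
  have : CompleteSpace (fderiv ℝ f x₀).ker := FiniteDimensional.complete ℝ _
  let e' : E ≃L[ℝ] F × (fderiv ℝ f x₀).ker :=
    ContinuousLinearMap.equivProdOfSurjectiveOfIsCompl (fderiv ℝ f x₀) P
      (LinearMap.range_eq_top.2 hs) (LinearMap.range_eq_top.2 fun y => ⟨y, hP y⟩)
      (LinearMap.isCompl_of_proj hP)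
  let φ : E → F × (fderiv ℝ f x₀).ker := fun x => (f x, P x)
  have hφ : ContDiffOn ℝ (⊤ : ℕ∞) φ D := hf.prodMk P.contDiff.contDiffOn
  have hφa : ∀ x ∈ D, ContDiffAt ℝ (⊤ : ℕ∞) φ x := fun x hx => hφ.contDiffAt (hD.mem_nhds hx)
  have hfd : HasFDerivAt f (fderiv ℝ f x₀) x₀ :=
    ((hf.contDiffAt (hD.mem_nhds hx₀)).differentiableAt (by simp)).hasFDerivAt
  have hφd : HasFDerivAt φ (e' : E →L[ℝ] F × (fderiv ℝ f x₀).ker) x₀ := hfd.prodMk P.hasFDerivAt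
  let e := (hφa x₀ hx₀).toOpenPartialHomeomorph φ hφd (by simp)
  have hes : x₀ ∈ e.source := (hφa x₀ hx₀).mem_toOpenPartialHomeomorph_source hφd (by simp)
  have het : φ x₀ ∈ e.target :=
    (hφa x₀ hx₀).image_mem_toOpenPartialHomeomorph_target hφd (by simp)
  have hee : ∀ x, e x = φ x := fun x => rfl
  -- points near `x₀` where the derivative is invertible
  have hinv : ∀ᶠ x in 𝓝 x₀, fderiv ℝ φ x ∈
      range (ContinuousLinearEquiv.toContinuousLinearMap :
        (E ≃L[ℝ] F × (fderiv ℝ f x₀).ker) → _) := by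
    have hc : ContinuousAt (fderiv ℝ φ) x₀ :=
      ((hφa x₀ hx₀).fderiv_right (m := 0) (by simp)).continuousAt
    apply hc
    rw [hφd.fderiv]
    exact e'.nhds
  have hU : ∀ᶠ x in 𝓝 x₀, x ∈ D ∧ fderiv ℝ φ x ∈
      range (ContinuousLinearEquiv.toContinuousLinearMap :
        (E ≃L[ℝ] F × (fderiv ℝ f x₀).ker) → _) := (hD.eventually_mem hx₀).and hinv
  have hsymm : Tendsto e.symm (𝓝 (φ x₀)) (𝓝 x₀) := e.tendsto_symm hes
  obtain ⟨r, hr, hball⟩ := Metric.eventually_nhds_iff_ball.1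
    ((e.open_target.eventually_mem het).and (hsymm.eventually hU))
  have hψ : ∀ y ∈ Metric.ball (φ x₀) r, ContDiffAt ℝ (⊤ : ℕ∞) e.symm y := by
    intro y hy
    obtain ⟨h1, h2, e₂, h3⟩ := hball y hy
    refine e.contDiffAt_symm (f₀' := e₂) h1 ?_ (hφa _ h2)
    rw [h3]
    exact ((hφa _ h2).differentiableAt (by simp)).hasFDerivAt
  let χ : ContDiffBump (φ x₀) := ⟨r / 4, r / 2, by positivity, by linarith⟩
  let g : F × (fderiv ℝ f x₀).ker → G := fun y => χ y • X (e.symm y)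
  have hg : ContDiff ℝ (⊤ : ℕ∞) g := by
    rw [contDiff_iff_contDiffAt]
    intro y
    by_cases hy : y ∈ Metric.ball (φ x₀) r
    · refine χ.contDiffAt.smul ?_
      have h2 := (hball y hy).2.1
      exact ContDiffAt.comp y (hX.contDiffAt (hD.mem_nhds h2)) (hψ y hy)
    · have : y ∉ Metric.closedBall (φ x₀) (r / 2) := fun h =>
        hy (Metric.closedBall_subset_ball (by linarith) h)
      have hz : g =ᶠ[𝓝 y] fun _ => 0 := by
        filter_upwards [Metric.isClosed_closedBall.isOpen_compl.mem_nhds this] with z hz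
        have : χ z = 0 := χ.zero_of_le_dist (by
          have : ¬ dist z (φ x₀) ≤ r / 2 := hz
          exact (not_le.1 this).le)
        simp [g, this]
      exact contDiffAt_const.congr_of_eventuallyEq hz
  have hg0 : ∀ w, g (0, w) = 0 := by
    intro w
    by_cases hy : ((0 : F), w) ∈ Metric.ball (φ x₀) r
    · obtain ⟨h1, h2, -⟩ := hball _ hy
      have h4 : φ (e.symm (0, w)) = (0, w) := e.right_inv h1
      have h5 : f (e.symm (0, w)) = 0 := congrArg Prod.fst h4
      simp [g, h0 _ h2 h5]
    · have : χ ((0 : F), w) = 0 := χ.zero_of_le_dist (by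
        have h : ¬ dist ((0 : F), w) (φ x₀) < r := hy
        have h' : r / 2 ≤ dist ((0 : F), w) (φ x₀) := by linarith [not_lt.1 h]
        exact h')
      simp [g, this]
  obtain ⟨H, hH, hgH⟩ := aux_hadamard g hg hg0
  have hev : ∀ᶠ x in 𝓝 x₀, x ∈ D ∧ x ∈ e.source ∧ φ x ∈ Metric.ball (φ x₀) (r / 4) :=
    (hD.eventually_mem hx₀).and ((e.open_source.eventually_mem hes).and
      ((hφa x₀ hx₀).continuousAt (Metric.ball_mem_nhds _ (by positivity))))
  refine ⟨_, hev, fun x => H (φ x), ?_, ?_⟩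
  · exact hH.comp_contDiffOn (hφ.mono fun x hx => hx.1)
  · rintro x ⟨-, h2, h3⟩
    have h4 : χ (φ x) = 1 := χ.one_of_mem_closedBall (Metric.ball_subset_closedBall h3)
    have h5 : e.symm (φ x) = x := e.left_inv h2
    have h6 := hgH (φ x)
    simpa [g, h4, h5] using h6

open Set Filter Topology MeasureTheory in
theorem aux_surj {n k : ℕ} (f : (Fin n → ℝ) → Fin k → ℝ) (x : Fin n → ℝ)
    (hf : DifferentiableAt ℝ f x)
    (hrank :
      (Matrix.of fun (a : Fin k) (i : Fin n) => pd (fun y => f y a) i x).rank = k) :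
    Function.Surjective (fderiv ℝ f x) := by
  set J := (Matrix.of fun (a : Fin k) (i : Fin n) => pd (fun y => f y a) i x) with hJ
  have h1 : ∀ v, fderiv ℝ f x v = J.mulVecLin v := by
    intro v
    have h2 : ∀ a i, J a i = fderiv ℝ f x (Pi.single i 1) a := by
      intro a i
      have h3 : HasFDerivAt (fun y => f y a)
        ((ContinuousLinearMap.proj (R := ℝ) (φ := fun _ : Fin k => ℝ) a).comp (fderiv ℝ f x)) x :=
        (hasFDerivAt_pi'.1 hf.hasFDerivAt) a
      simp [hJ, pd, h3.fderiv]
    funext a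
    simp only [Matrix.mulVecLin_apply, Matrix.mulVec, dotProduct, h2]
    conv_lhs => rw [pi_eq_sum_univ' v]
    simp [mul_comm]
  have h4 : J.mulVecLin.range = ⊤ := by
    apply Submodule.eq_top_of_finrank_eq
    simpa [Matrix.rank] using hrank
  intro w
  obtain ⟨v, hv⟩ := LinearMap.range_eq_top.1 h4 w
  exact ⟨v, (h1 v).trans hv⟩

open Set Filter Topology MeasureTheory in
open scoped Manifold in
theorem aux_global {n k : ℕ}
    (D : Set (Fin n → ℝ)) (hD : IsOpen D)
    (f : (Fin n → ℝ) → Fin k → ℝ) (hf : ContDiffOn ℝ (⊤ : ℕ∞) f D)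
    (hrank : ∀ x ∈ D,
      (Matrix.of fun (a : Fin k) (i : Fin n) => pd (fun y => f y a) i x).rank = k)
    (X : (Fin n → ℝ) → Fin n → ℝ) (hX : ContDiffOn ℝ (⊤ : ℕ∞) X D)
    (h : ∀ x ∈ D, f x = 0 → X x = 0) :
    ∃ Y : Fin k → (Fin n → ℝ) → Fin n → ℝ,
        (∀ a, ContDiffOn ℝ (⊤ : ℕ∞) (Y a) D) ∧
        ∀ x ∈ D, ∀ i, X x i = ∑ a, f x a * Y a x i := by
  classical
  let U : TopologicalSpace.Opens (Fin n → ℝ) := ⟨D, hD⟩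
  have : LocallyCompactSpace U := hD.locallyCompactSpace
  have : SigmaCompactSpace U := sigmaCompactSpace_of_locallyCompact_secondCountable
  let t : U → Set (Fin k → Fin n → ℝ) := fun x => {Y | ∀ i, X x i = ∑ a, f x a * Y a i}
  have ht : ∀ x, Convex ℝ (t x) := by
    intro x Y hY Z hZ a b ha hb hab i
    have h1 := hY i
    have h2 := hZ i
    simp only [Pi.add_apply, Pi.smul_apply, smul_eq_mul, mul_add, Finset.sum_add_distrib]
    have h3 : ∀ (c : ℝ) (W : Fin k → Fin n → ℝ),
        ∑ j, f x j * (c * W j i) = c * ∑ j, f x j * W j i := by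
      intro c W
      rw [Finset.mul_sum]
      exact Finset.sum_congr rfl fun j _ => by ring
    rw [h3, h3, ← h1, ← h2, ← add_mul, hab, one_mul]
  obtain ⟨g, hg⟩ := exists_contMDiffMap_forall_mem_convex_of_local (n := (⊤ : ℕ∞))
    𝓘(ℝ, Fin n → ℝ) ht (by
      intro x
      have hs := aux_surj f x.1
        ((hf.contDiffAt (hD.mem_nhds x.2)).differentiableAt (by simp)) (hrank x.1 x.2)
      obtain ⟨V, hV, A, hA, hXA⟩ := aux_local D hD f hf X hX h x.1 x.2 hs
      obtain ⟨W, hWV, hWo, hxW⟩ := mem_nhds_iff.1 hV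
      let B : (Fin n → ℝ) → Fin k → Fin n → ℝ := fun y a => A y (Pi.single a 1)
      refine ⟨Subtype.val ⁻¹' W, (hWo.preimage continuous_subtype_val).mem_nhds hxW,
        fun y => B y, ?_, ?_⟩
      · intro y hy
        refine ContMDiffAt.contMDiffWithinAt ?_
        refine contMDiffAt_subtype_iff (f := B) |>.2 ?_
        rw [contMDiffAt_iff_contDiffAt]
        have h1 := (hA.mono hWV).contDiffAt (hWo.mem_nhds hy)
        exact contDiffAt_pi.2 fun a => h1.clm_apply contDiffAt_const
      · intro y hy i
        rw [hXA y (hWV hy)]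
        conv_lhs => rw [pi_eq_sum_univ' (f y)]
        simp [B])
  let Z : (Fin n → ℝ) → Fin k → Fin n → ℝ := fun x => if hx : x ∈ D then g ⟨x, hx⟩ else 0
  have hZ : ContDiffOn ℝ (⊤ : ℕ∞) Z D := by
    intro x hx
    refine ContDiffAt.contDiffWithinAt ?_
    rw [← contMDiffAt_iff_contDiffAt]
    refine (contMDiffAt_subtype_iff (U := U) (f := Z) (x := ⟨x, hx⟩)).1 ?_
    have : (fun x : U => Z x) = g := by
      funext y
      exact dif_pos y.2
    rw [this]
    exact g.contMDiff.contMDiffAt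
  refine ⟨fun a x => Z x a, fun a => contDiffOn_pi.1 hZ a, fun x hx i => ?_⟩
  have h1 := hg ⟨x, hx⟩ i
  simpa [Z, hx] using h1

/-- For a smooth vector field `X` on `D` the following are equivalent:
(i) `X(h)` vanishes on `M = {x ∈ D | f x = 0}` for every smooth `h`;
(ii) `X` vanishes at every point of `M`;
(iii) `X = Σ_a fᵃ Y_a` on `D` for smooth vector fields `Y_a`. -/
theorem statement1 {n k : ℕ} (hk : 0 < k) (hkn : k < n)
    (D : Set (Fin n → ℝ)) (hD : IsOpen D)
    (f : (Fin n → ℝ) → Fin k → ℝ) (hf : ContDiffOn ℝ (⊤ : ℕ∞) f D)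
    (hrank : ∀ x ∈ D,
      (Matrix.of fun (a : Fin k) (i : Fin n) => pd (fun y => f y a) i x).rank = k)
    (X : (Fin n → ℝ) → Fin n → ℝ) (hX : ContDiffOn ℝ (⊤ : ℕ∞) X D) :
    ((∀ h : (Fin n → ℝ) → ℝ, ContDiffOn ℝ (⊤ : ℕ∞) h D →
        ∀ x ∈ D, f x = 0 → vact X h x = 0) ↔
      (∀ x ∈ D, f x = 0 → X x = 0)) ∧
    ((∀ x ∈ D, f x = 0 → X x = 0) ↔
      (∃ Y : Fin k → (Fin n → ℝ) → Fin n → ℝ,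
        (∀ a, ContDiffOn ℝ (⊤ : ℕ∞) (Y a) D) ∧
        ∀ x ∈ D, ∀ i, X x i = ∑ a, f x a * Y a x i)) := by
  refine ⟨⟨fun h x hx hfx => ?_, fun h g _ x hx hfx => ?_⟩, ⟨fun h => ?_, ?_⟩⟩
  · funext j
    have h1 := h (fun y => y j) (by fun_prop) x hx hfx
    have h2 : ∀ i, pd (fun y : Fin n → ℝ => y j) i x = (Pi.single i 1 : Fin n → ℝ) j := by
      intro i
      have h3 : HasFDerivAt (fun y : Fin n → ℝ => y j)
        (ContinuousLinearMap.proj (R := ℝ) (φ := fun _ : Fin n => ℝ) j) x :=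
        (ContinuousLinearMap.proj (R := ℝ) (φ := fun _ : Fin n => ℝ) j).hasFDerivAt
      simp [pd, h3.fderiv]
    simpa [vact, h2, Pi.single_apply] using h1
  · simp [vact, h x hx hfx]
  · exact aux_global D hD f hf hrank X hX h
  · rintro ⟨Y, -, hY⟩ x hx hfx
    funext i
    simp [hY x hx i, hfx]
end
end

section
/- For a smooth 1-form ω on D the following are equivalent: (i) ⟨X, ω⟩ vanishes at every point of M for every smooth vector field X such that X(f^a) vanishes at every point of M for every a; (ii) ⟨X, ω⟩ vanishes at every point of M for every tangent vector field X. -/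
open scoped BigOperators

noncomputable section

/-- `g(X,Y) = Σ_{i,j} g_{ij} Xⁱ Yʲ`. -/
def gpair {n : ℕ} (g : (Fin n → ℝ) → Fin n → Fin n → ℝ)
    (X Y : (Fin n → ℝ) → Fin n → ℝ) (x : Fin n → ℝ) : ℝ :=
  ∑ i, ∑ j, g x i j * X x i * Y x j

/-- The components `g^{ij}` of the inverse metric. -/
def ginv {n : ℕ} (g : (Fin n → ℝ) → Fin n → Fin n → ℝ) (x : Fin n → ℝ)
    (i j : Fin n) : ℝ :=
  (Matrix.of (g x))⁻¹ i j

/-- `f^{a i} = Σ_j g^{ij} ∂_j f^a`. -/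
def fup {n k : ℕ} (g : (Fin n → ℝ) → Fin n → Fin n → ℝ)
    (f : (Fin n → ℝ) → Fin k → ℝ) (a : Fin k) (i : Fin n) (x : Fin n → ℝ) : ℝ :=
  ∑ j, ginv g x i j * pd (fun y => f y a) j x

/-- `E^{ab} = Σ_i f^{a i} ∂_i f^b`. -/
def Emat {n k : ℕ} (g : (Fin n → ℝ) → Fin n → Fin n → ℝ)
    (f : (Fin n → ℝ) → Fin k → ℝ) (x : Fin n → ℝ) : Fin k → Fin k → ℝ :=
  fun a b => ∑ i, fup g f a i x * pd (fun y => f y b) i x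

/-- `K = E⁻¹`. -/
def Kmat {n k : ℕ} (g : (Fin n → ℝ) → Fin n → Fin n → ℝ)
    (f : (Fin n → ℝ) → Fin k → ℝ) (x : Fin n → ℝ) : Fin k → Fin k → ℝ :=
  fun a b => (Matrix.of (Emat g f x))⁻¹ a b

/-- The normal vector fields `(N_⊥^a)^i = Σ_b K^{ab} f^{b i}`. -/
def Nperp {n k : ℕ} (g : (Fin n → ℝ) → Fin n → Fin n → ℝ)
    (f : (Fin n → ℝ) → Fin k → ℝ) (a : Fin k) (x : Fin n → ℝ) : Fin n → ℝ :=
  fun i => ∑ b, Kmat g f x a b * fup g f b i x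

/-- The normal projection `X_⊥ = Σ_a X(f^a) N_⊥^a` of a vector field. -/
def perpPart {n k : ℕ} (g : (Fin n → ℝ) → Fin n → Fin n → ℝ)
    (f : (Fin n → ℝ) → Fin k → ℝ) (X : (Fin n → ℝ) → Fin n → ℝ)
    (x : Fin n → ℝ) : Fin n → ℝ :=
  fun i => ∑ a, vact X (fun y => f y a) x * Nperp g f a x i

/-- The tangential projection `X_t = X − X_⊥` of a vector field. -/
def tangPart {n k : ℕ} (g : (Fin n → ℝ) → Fin n → Fin n → ℝ)
    (f : (Fin n → ℝ) → Fin k → ℝ) (X : (Fin n → ℝ) → Fin n → ℝ)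
    (x : Fin n → ℝ) : Fin n → ℝ :=
  fun i => X x i - perpPart g f X x i

theorem aux_det {n m : ℕ} {D : Set (Fin n → ℝ)} (A : (Fin n → ℝ) → Matrix (Fin m) (Fin m) ℝ)
    (hA : ∀ i j, ContDiffOn ℝ (⊤ : ℕ∞) (fun x => A x i j) D) :
    ContDiffOn ℝ (⊤ : ℕ∞) (fun x => (A x).det) D := by
  simp only [Matrix.det_apply']
  refine ContDiffOn.sum fun σ _ => contDiffOn_const.mul ?_
  exact contDiffOn_prod fun i _ => hA _ _

theorem aux_inv {n m : ℕ} {D : Set (Fin n → ℝ)} (A : (Fin n → ℝ) → Matrix (Fin m) (Fin m) ℝ)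
    (hA : ∀ i j, ContDiffOn ℝ (⊤ : ℕ∞) (fun x => A x i j) D)
    (hu : ∀ x ∈ D, IsUnit (A x)) (i j : Fin m) :
    ContDiffOn ℝ (⊤ : ℕ∞) (fun x => (A x)⁻¹ i j) D := by
  simp only [Matrix.inv_def, Matrix.smul_apply, Ring.inverse_eq_inv', smul_eq_mul,
    Matrix.adjugate_apply]
  refine ((aux_det A hA).inv fun x hx => ?_).mul (aux_det _ ?_)
  · exact ((Matrix.isUnit_iff_isUnit_det _).1 (hu x hx)).ne_zero
  · intro a b
    simp only [Matrix.updateRow_apply]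
    split_ifs
    · exact contDiffOn_const
    · exact hA _ _

theorem aux_pd {n : ℕ} {D : Set (Fin n → ℝ)} (hD : IsOpen D) (h : (Fin n → ℝ) → ℝ)
    (hh : ContDiffOn ℝ (⊤ : ℕ∞) h D) (i : Fin n) :
    ContDiffOn ℝ (⊤ : ℕ∞) (fun x => pd h i x) D := by
  unfold pd
  have h1 := hh.fderiv_of_isOpen (m := ((⊤ : ℕ∞) : WithTop ℕ∞)) hD (by simp)
  exact h1.clm_apply contDiffOn_const

theorem aux_tang {n k : ℕ} (g : (Fin n → ℝ) → Fin n → Fin n → ℝ)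
    (f : (Fin n → ℝ) → Fin k → ℝ) (X : (Fin n → ℝ) → Fin n → ℝ) (x : Fin n → ℝ)
    (hE : IsUnit (Matrix.of (Emat g f x))) (b : Fin k) :
    vact (tangPart g f X) (fun y => f y b) x = 0 := by
  have hN : ∀ a, ∑ i, Nperp g f a x i * pd (fun y => f y b) i x
      = (1 : Matrix (Fin k) (Fin k) ℝ) a b := by
    intro a
    rw [← Matrix.nonsing_inv_mul _ ((Matrix.isUnit_iff_isUnit_det _).1 hE), Matrix.mul_apply]
    simp only [Nperp, Kmat, Finset.sum_mul, Matrix.of_apply]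
    rw [Finset.sum_comm]
    refine Finset.sum_congr rfl fun c _ => ?_
    simp only [Emat, Finset.mul_sum, mul_assoc]
  have hP : ∑ i, perpPart g f X x i * pd (fun y => f y b) i x = vact X (fun y => f y b) x := by
    simp only [perpPart, Finset.sum_mul]
    rw [Finset.sum_comm]
    simp only [mul_assoc, ← Finset.mul_sum, hN, Matrix.one_apply]
    simp
  have : vact (tangPart g f X) (fun y => f y b) x
      = vact X (fun y => f y b) x - ∑ i, perpPart g f X x i * pd (fun y => f y b) i x := by
    simp only [vact, tangPart, sub_mul, Finset.sum_sub_distrib]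
  rw [this, hP, sub_self]

theorem aux_smooth {n k : ℕ} {D : Set (Fin n → ℝ)} (hD : IsOpen D)
    (f : (Fin n → ℝ) → Fin k → ℝ) (hf : ContDiffOn ℝ (⊤ : ℕ∞) f D)
    (g : (Fin n → ℝ) → Fin n → Fin n → ℝ) (hg : ContDiffOn ℝ (⊤ : ℕ∞) g D)
    (hginv : ∀ x ∈ D, IsUnit (Matrix.of (g x)))
    (hE : ∀ x ∈ D, IsUnit (Matrix.of (Emat g f x)))
    (X : (Fin n → ℝ) → Fin n → ℝ) (hX : ContDiffOn ℝ (⊤ : ℕ∞) X D) :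
    ContDiffOn ℝ (⊤ : ℕ∞) (tangPart g f X) D := by
  have hp : ∀ a i, ContDiffOn ℝ (⊤ : ℕ∞) (fun x => pd (fun y => f y a) i x) D :=
    fun a i => aux_pd hD _ (contDiffOn_pi.1 hf a) i
  have hgi : ∀ i j, ContDiffOn ℝ (⊤ : ℕ∞) (fun x => ginv g x i j) D :=
    fun i j => aux_inv (fun x => Matrix.of (g x))
      (fun i j => contDiffOn_pi.1 (contDiffOn_pi.1 hg i) j) hginv i j
  have hfu : ∀ a i, ContDiffOn ℝ (⊤ : ℕ∞) (fun x => fup g f a i x) D :=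
    fun a i => ContDiffOn.sum fun j _ => (hgi i j).mul (hp a j)
  have hEm : ∀ a b, ContDiffOn ℝ (⊤ : ℕ∞) (fun x => Emat g f x a b) D :=
    fun a b => ContDiffOn.sum fun i _ => (hfu a i).mul (hp b i)
  have hK : ∀ a b, ContDiffOn ℝ (⊤ : ℕ∞) (fun x => Kmat g f x a b) D :=
    fun a b => aux_inv (fun x => Matrix.of (Emat g f x)) hEm hE a b
  have hN : ∀ a i, ContDiffOn ℝ (⊤ : ℕ∞) (fun x => Nperp g f a x i) D :=
    fun a i => ContDiffOn.sum fun b _ => (hK a b).mul (hfu b i)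
  have hXi := contDiffOn_pi.1 hX
  have hv : ∀ a, ContDiffOn ℝ (⊤ : ℕ∞) (fun x => vact X (fun y => f y a) x) D :=
    fun a => ContDiffOn.sum fun i _ => (hXi i).mul (hp a i)
  refine contDiffOn_pi.2 fun i => (hXi i).sub ?_
  exact ContDiffOn.sum fun a _ => (hv a).mul (hN a i)

/-- For a smooth 1-form `ω` on `D`, `⟨X, ω⟩` vanishes on `M` for every smooth
vector field `X` whose action on the `f^a` vanishes on `M` if and only if it
does so for every tangent vector field `X`. -/
theorem statement10 {n k : ℕ} (hk : 0 < k) (hkn : k < n)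
    (D : Set (Fin n → ℝ)) (hD : IsOpen D)
    (f : (Fin n → ℝ) → Fin k → ℝ) (hf : ContDiffOn ℝ (⊤ : ℕ∞) f D)
    (hrank : ∀ x ∈ D,
      (Matrix.of fun (a : Fin k) (i : Fin n) => pd (fun y => f y a) i x).rank = k)
    (g : (Fin n → ℝ) → Fin n → Fin n → ℝ) (hg : ContDiffOn ℝ (⊤ : ℕ∞) g D)
    (hgsym : ∀ x ∈ D, ∀ i j, g x i j = g x j i)
    (hginv : ∀ x ∈ D, IsUnit (Matrix.of (g x)))
    (hE : ∀ x ∈ D, IsUnit (Matrix.of (Emat g f x)))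
    (ω : (Fin n → ℝ) → Fin n → ℝ) (hω : ContDiffOn ℝ (⊤ : ℕ∞) ω D) :
    (∀ X : (Fin n → ℝ) → Fin n → ℝ, ContDiffOn ℝ (⊤ : ℕ∞) X D →
        (∀ a, ∀ x ∈ D, f x = 0 → vact X (fun y => f y a) x = 0) →
        ∀ x ∈ D, f x = 0 → ∑ i, X x i * ω x i = 0) ↔
    (∀ X : (Fin n → ℝ) → Fin n → ℝ, ContDiffOn ℝ (⊤ : ℕ∞) X D →
        (∀ a, ∀ x ∈ D, vact X (fun y => f y a) x = 0) →
        ∀ x ∈ D, f x = 0 → ∑ i, X x i * ω x i = 0) := by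
  constructor
  · intro h X hX hXf
    exact h X hX fun a x hx _ => hXf a x hx
  · intro h X hX hXf x hx hfx
    have key := h (tangPart g f X) (aux_smooth hD f hf g hg hginv hE X hX)
      (fun a y hy => aux_tang g f X y (hE y hy) a) x hx hfx
    have e : tangPart g f X x = X x := by
      funext i
      simp [tangPart, perpPart, fun a => hXf a x hx hfx]
    rwa [e] at key
end
end

section
/- Define, for tangent vector fields X, Y, Z on D, the tangential curvature R_t(X, Y)Z = ∇_t,X(∇_t,Y Z) − ∇_t,Y(∇_t,X Z) − ∇_t,[X,Y] Z. Then for all tangent vector fields X, Y, Z, W on D the Gauss equation holds: η(R_t(X, Y)Z, W) = η(II(Y, Z), II(X, W)) − η(II(X, Z), II(Y, W)) identically on D. -/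
open scoped BigOperators

noncomputable section

/-- The flat covariant derivative `(∇_X Y)ʲ = Σᵢ Xⁱ ∂ᵢYʲ`. -/
def nablaFlat {n : ℕ} (X Y : (Fin n → ℝ) → Fin n → ℝ) (x : Fin n → ℝ) :
    Fin n → ℝ :=
  fun j => ∑ i, X x i * pd (fun y => Y y j) i x

/-- The second fundamental form `II(X,Y) = (∇_X Y)_⊥` (constant metric `η`). -/
def IIflat {n k : ℕ} (η : Fin n → Fin n → ℝ) (f : (Fin n → ℝ) → Fin k → ℝ)
    (X Y : (Fin n → ℝ) → Fin n → ℝ) : (Fin n → ℝ) → Fin n → ℝ :=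
  fun x => perpPart (fun _ => η) f (nablaFlat X Y) x

/-- The projected connection `∇_{t,X} Y = (∇_X Y)_t` (constant metric `η`). -/
def nablaTflat {n k : ℕ} (η : Fin n → Fin n → ℝ) (f : (Fin n → ℝ) → Fin k → ℝ)
    (X Y : (Fin n → ℝ) → Fin n → ℝ) : (Fin n → ℝ) → Fin n → ℝ :=
  fun x => tangPart (fun _ => η) f (nablaFlat X Y) x

/-- The tangential curvature
`R_t(X,Y)Z = ∇_{t,X}(∇_{t,Y} Z) − ∇_{t,Y}(∇_{t,X} Z) − ∇_{t,[X,Y]} Z`. -/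
def Rtflat {n k : ℕ} (η : Fin n → Fin n → ℝ) (f : (Fin n → ℝ) → Fin k → ℝ)
    (X Y Z : (Fin n → ℝ) → Fin n → ℝ) : (Fin n → ℝ) → Fin n → ℝ :=
  fun x j => nablaTflat η f X (nablaTflat η f Y Z) x j
    - nablaTflat η f Y (nablaTflat η f X Z) x j
    - nablaTflat η f (lie X Y) Z x j

lemma two_le_smooth : (2 : WithTop ℕ∞) ≤ ((⊤ : ℕ∞) : WithTop ℕ∞) :=
  WithTop.coe_le_coe.2 (le_top : (2 : ℕ∞) ≤ ⊤)

/-- The constant bilinear form. -/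
def BB {n : ℕ} (η : Fin n → Fin n → ℝ) (u v : Fin n → ℝ) : ℝ :=
  ∑ i, ∑ j, η i j * u i * v j

lemma BB_sub_left {n : ℕ} (η : Fin n → Fin n → ℝ) (u v w : Fin n → ℝ) :
    BB η (u - v) w = BB η u w - BB η v w := by
  simp only [BB, ← Finset.sum_sub_distrib]
  refine Finset.sum_congr rfl fun i _ => Finset.sum_congr rfl fun j _ => ?_
  simp only [Pi.sub_apply]; ring

lemma BB_sub_right {n : ℕ} (η : Fin n → Fin n → ℝ) (u v w : Fin n → ℝ) :
    BB η u (v - w) = BB η u v - BB η u w := by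
  simp only [BB, ← Finset.sum_sub_distrib]
  refine Finset.sum_congr rfl fun i _ => Finset.sum_congr rfl fun j _ => ?_
  simp only [Pi.sub_apply]; ring

lemma BB_sum_left {n : ℕ} {ι : Type*} (s : Finset ι) (η : Fin n → Fin n → ℝ)
    (c : ι → ℝ) (u : ι → Fin n → ℝ) (w : Fin n → ℝ) :
    BB η (fun i => ∑ a ∈ s, c a * u a i) w = ∑ a ∈ s, c a * BB η (u a) w := by
  simp only [BB, Finset.mul_sum, Finset.sum_mul]
  symm
  rw [Finset.sum_comm]
  refine Finset.sum_congr rfl fun i _ => ?_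
  rw [Finset.sum_comm]
  refine Finset.sum_congr rfl fun j _ => Finset.sum_congr rfl fun a _ => ?_
  ring

lemma sum_pd {n : ℕ} (h : (Fin n → ℝ) → ℝ) (x u : Fin n → ℝ) :
    ∑ i, u i * pd h i x = fderiv ℝ h x u := by
  have := LinearMap.pi_apply_eq_sum_univ (fderiv ℝ h x : (Fin n → ℝ) →ₗ[ℝ] ℝ) u
  simp only [ContinuousLinearMap.coe_coe] at this
  rw [this]
  refine Finset.sum_congr rfl fun i _ => ?_
  simp only [pd, smul_eq_mul]
  congr 2
  ext j
  simp [Pi.single_apply, eq_comm]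

lemma vact_eq {n : ℕ} (X : (Fin n → ℝ) → Fin n → ℝ) (h : (Fin n → ℝ) → ℝ)
    (x : Fin n → ℝ) : vact X h x = fderiv ℝ h x (X x) := sum_pd h x (X x)

lemma fderiv_comp_apply {n m : ℕ} {Y : (Fin n → ℝ) → Fin m → ℝ} {x : Fin n → ℝ}
    (hY : DifferentiableAt ℝ Y x) (j : Fin m) (u : Fin n → ℝ) :
    fderiv ℝ (fun y => Y y j) x u = fderiv ℝ Y x u j := by
  rw [(hasFDerivAt_pi'.1 hY.hasFDerivAt j).fderiv]; rfl

lemma nablaFlat_eq {n : ℕ} {X Y : (Fin n → ℝ) → Fin n → ℝ} {x : Fin n → ℝ}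
    (hY : DifferentiableAt ℝ Y x) : nablaFlat X Y x = fderiv ℝ Y x (X x) := by
  ext j
  rw [← fderiv_comp_apply hY, ← sum_pd]; rfl

lemma lie_eq {n : ℕ} {X Y : (Fin n → ℝ) → Fin n → ℝ} {x : Fin n → ℝ}
    (hX : DifferentiableAt ℝ X x) (hY : DifferentiableAt ℝ Y x) :
    lie X Y x = fderiv ℝ Y x (X x) - fderiv ℝ X x (Y x) := by
  ext j
  rw [Pi.sub_apply, ← fderiv_comp_apply hY, ← fderiv_comp_apply hX, ← sum_pd, ← sum_pd,
    ← Finset.sum_sub_distrib]; rfl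

lemma BB_fup {n k : ℕ} {η : Fin n → Fin n → ℝ} (hs : ∀ i j, η i j = η j i)
    (hi : IsUnit (Matrix.of η)) (f : (Fin n → ℝ) → Fin k → ℝ) (a : Fin k)
    (x u : Fin n → ℝ) :
    BB η (fun i => fup (fun _ => η) f a i x) u = fderiv ℝ (fun y => f y a) x u := by
  rw [← sum_pd]
  simp only [BB]
  rw [Finset.sum_comm]
  refine Finset.sum_congr rfl fun j _ => ?_
  have h1 : ∀ l, ∑ i, η i j * (Matrix.of η)⁻¹ i l = (1 : Matrix (Fin n) (Fin n) ℝ) j l := by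
    intro l
    rw [← Matrix.mul_nonsing_inv (Matrix.of η) ((Matrix.isUnit_iff_isUnit_det _).1 hi),
      Matrix.mul_apply]
    refine Finset.sum_congr rfl fun i _ => ?_
    rw [hs i j]; rfl
  rw [← Finset.sum_mul, mul_comm]
  congr 1
  simp only [fup, ginv, Finset.mul_sum]
  rw [Finset.sum_comm]
  simp only [← mul_assoc, ← Finset.sum_mul, h1]
  simp [Matrix.one_apply]

lemma BB_perp {n k : ℕ} {η : Fin n → Fin n → ℝ} (hs : ∀ i j, η i j = η j i)
    (hi : IsUnit (Matrix.of η)) (f : (Fin n → ℝ) → Fin k → ℝ)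
    (V : (Fin n → ℝ) → Fin n → ℝ) (x u : Fin n → ℝ)
    (hu : ∀ a, fderiv ℝ (fun y => f y a) x u = 0) :
    BB η (perpPart (fun _ => η) f V x) u = 0 := by
  unfold perpPart
  rw [BB_sum_left]
  refine Finset.sum_eq_zero fun a _ => ?_
  unfold Nperp
  rw [BB_sum_left]
  simp [BB_fup hs hi, hu]

lemma fderiv_perp {n k : ℕ} {η : Fin n → Fin n → ℝ} (f : (Fin n → ℝ) → Fin k → ℝ)
    (V : (Fin n → ℝ) → Fin n → ℝ) (x : Fin n → ℝ)
    (hE : IsUnit (Matrix.of (Emat (fun _ => η) f x))) (a : Fin k) :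
    fderiv ℝ (fun y => f y a) x (perpPart (fun _ => η) f V x)
      = fderiv ℝ (fun y => f y a) x (V x) := by
  have hN : ∀ c, ∑ i, Nperp (fun _ => η) f c x i * pd (fun y => f y a) i x
      = (1 : Matrix (Fin k) (Fin k) ℝ) c a := by
    intro c
    rw [← Matrix.nonsing_inv_mul _ ((Matrix.isUnit_iff_isUnit_det _).1 hE), Matrix.mul_apply]
    simp only [Nperp, Finset.sum_mul, Kmat, Matrix.of_apply]
    rw [Finset.sum_comm]
    refine Finset.sum_congr rfl fun b _ => ?_
    conv_rhs => rw [Emat, Finset.mul_sum]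
    simp only [mul_assoc]
  rw [← sum_pd]
  simp only [perpPart, Finset.sum_mul]
  rw [Finset.sum_comm]
  simp only [mul_assoc, ← Finset.mul_sum, hN]
  simp [Matrix.one_apply, vact_eq]

lemma hasFDerivAt_BB {n : ℕ} (η : Fin n → Fin n → ℝ) {U W : (Fin n → ℝ) → Fin n → ℝ}
    {x : Fin n → ℝ} (hU : DifferentiableAt ℝ U x) (hW : DifferentiableAt ℝ W x)
    (v : Fin n → ℝ) :
    fderiv ℝ (fun y => BB η (U y) (W y)) x v
      = BB η (fderiv ℝ U x v) (W x) + BB η (U x) (fderiv ℝ W x v) := by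
  have hU' := fun i => hasFDerivAt_pi'.1 hU.hasFDerivAt i
  have hW' := fun i => hasFDerivAt_pi'.1 hW.hasFDerivAt i
  have : HasFDerivAt (fun y => BB η (U y) (W y)) _ x :=
    HasFDerivAt.fun_sum fun i _ => HasFDerivAt.fun_sum fun j _ =>
      ((hU' i).const_mul (η i j)).mul (hW' j)
  rw [this.fderiv]
  simp only [BB, ← Finset.sum_add_distrib, ContinuousLinearMap.sum_apply]
  refine Finset.sum_congr rfl fun i _ => Finset.sum_congr rfl fun j _ => ?_
  simp
  ring

lemma diff_det {n m : ℕ} {M : (Fin n → ℝ) → Matrix (Fin m) (Fin m) ℝ} {x : Fin n → ℝ}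
    (hM : ∀ a b, DifferentiableAt ℝ (fun y => M y a b) x) :
    DifferentiableAt ℝ (fun y => (M y).det) x := by
  simp only [Matrix.det_apply']
  fun_prop

lemma diff_inv {n m : ℕ} {M : (Fin n → ℝ) → Matrix (Fin m) (Fin m) ℝ} {x : Fin n → ℝ}
    (hM : ∀ a b, DifferentiableAt ℝ (fun y => M y a b) x) (hx : IsUnit (M x)) (a b : Fin m) :
    DifferentiableAt ℝ (fun y => (M y)⁻¹ a b) x := by
  simp only [Matrix.inv_def, Matrix.smul_apply, Ring.inverse_eq_inv', smul_eq_mul,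
    Matrix.adjugate_apply]
  refine DifferentiableAt.mul ((diff_det hM).fun_inv ?_) (diff_det ?_)
  · exact ((Matrix.isUnit_iff_isUnit_det _).1 hx).ne_zero
  · intro c d
    by_cases h : c = b
    · subst h; simp
    · simpa [Matrix.updateRow_apply, h] using hM c d

lemma diff_perp {n k : ℕ} {η : Fin n → Fin n → ℝ} {f : (Fin n → ℝ) → Fin k → ℝ}
    {V : (Fin n → ℝ) → Fin n → ℝ} {x : Fin n → ℝ} (hf : ContDiffAt ℝ (⊤ : ℕ∞) f x)
    (hV : DifferentiableAt ℝ V x)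
    (hE : IsUnit (Matrix.of (Emat (fun _ => η) f x))) :
    DifferentiableAt ℝ (perpPart (fun _ => η) f V) x := by
  have hpd : ∀ a j, DifferentiableAt ℝ (fun y => pd (fun z => f z a) j y) x := by
    intro a j
    have h1 : ContDiffAt ℝ (⊤ : ℕ∞) (fun z => f z a) x := contDiffAt_pi.1 hf a
    have h2 : DifferentiableAt ℝ (fderiv ℝ (fun z => f z a)) x :=
      (h1.fderiv_right (m := 1) (by rw [one_add_one_eq_two]; exact two_le_smooth)).differentiableAt (by simp)
    exact h2.clm_apply (differentiableAt_const _)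
  have hfup : ∀ a i, DifferentiableAt ℝ (fun y => fup (fun _ => η) f a i y) x := by
    intro a i
    exact DifferentiableAt.fun_sum fun j _ => (hpd a j).const_mul _
  have hEm : ∀ a b, DifferentiableAt ℝ (fun y => Matrix.of (Emat (fun _ => η) f y) a b) x := by
    intro a b
    simp only [Emat, Matrix.of_apply]
    exact DifferentiableAt.fun_sum fun i _ => (hfup a i).fun_mul (hpd b i)
  have hK := diff_inv hEm hE
  have hV' : ∀ i, DifferentiableAt ℝ (fun y => V y i) x := differentiableAt_pi.1 hV
  refine differentiableAt_pi.2 fun i => ?_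
  exact DifferentiableAt.fun_sum fun a _ => DifferentiableAt.fun_mul
    (DifferentiableAt.fun_sum fun j _ => (hV' j).fun_mul (hpd a j))
    (DifferentiableAt.fun_sum fun b _ => (hK a b).fun_mul (hfup b i))

lemma fderiv_nabla {n : ℕ} {Y Z : (Fin n → ℝ) → Fin n → ℝ} {D : Set (Fin n → ℝ)}
    (hD : IsOpen D) (hY : ContDiffOn ℝ (⊤ : ℕ∞) Y D) (hZ : ContDiffOn ℝ (⊤ : ℕ∞) Z D)
    {x : Fin n → ℝ} (hx : x ∈ D) :
    DifferentiableAt ℝ (nablaFlat Y Z) x ∧ ∀ v, fderiv ℝ (nablaFlat Y Z) x v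
      = fderiv ℝ (fderiv ℝ Z) x v (Y x) + fderiv ℝ Z x (fderiv ℝ Y x v) := by
  have hZx := hZ.contDiffAt (hD.mem_nhds hx)
  have hYd : DifferentiableAt ℝ Y x :=
    (hY.contDiffAt (hD.mem_nhds hx)).differentiableAt (by simp)
  have h2 : DifferentiableAt ℝ (fderiv ℝ Z) x :=
    (hZx.fderiv_right (m := 1) (by rw [one_add_one_eq_two]; exact two_le_smooth)).differentiableAt (by simp)
  have he : nablaFlat Y Z =ᶠ[nhds x] fun y => fderiv ℝ Z y (Y y) := by
    filter_upwards [hD.mem_nhds hx] with y hy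
    exact nablaFlat_eq ((hZ.contDiffAt (hD.mem_nhds hy)).differentiableAt (by simp))
  have h3 := h2.hasFDerivAt.clm_apply hYd.hasFDerivAt
  have h4 := h3.congr_of_eventuallyEq he
  refine ⟨h4.differentiableAt, fun v => ?_⟩
  rw [h4.fderiv]
  simp [add_comm]

/-- Half of the Gauss equation. -/
lemma half {n k : ℕ} {D : Set (Fin n → ℝ)} (hD : IsOpen D)
    {f : (Fin n → ℝ) → Fin k → ℝ} (hf : ContDiffOn ℝ (⊤ : ℕ∞) f D)
    {η : Fin n → Fin n → ℝ} (hs : ∀ i j, η i j = η j i)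
    (hi : IsUnit (Matrix.of η))
    (hE : ∀ x ∈ D, IsUnit (Matrix.of (Emat (fun _ => η) f x)))
    {X Y Z W : (Fin n → ℝ) → Fin n → ℝ}
    (hY : ContDiffOn ℝ (⊤ : ℕ∞) Y D)
    (hZ : ContDiffOn ℝ (⊤ : ℕ∞) Z D) (hW : ContDiffOn ℝ (⊤ : ℕ∞) W D)
    (hWt : ∀ a, ∀ x ∈ D, vact W (fun y => f y a) x = 0)
    {x : Fin n → ℝ} (hx : x ∈ D) :
    BB η (nablaTflat η f X (nablaTflat η f Y Z) x) (W x)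
      = BB η (fderiv ℝ (fderiv ℝ Z) x (X x) (Y x) + fderiv ℝ Z x (fderiv ℝ Y x (X x))) (W x)
        + BB η (IIflat η f Y Z x) (IIflat η f X W x) := by
  have hWd : DifferentiableAt ℝ W x :=
    (hW.contDiffAt (hD.mem_nhds hx)).differentiableAt (by simp)
  obtain ⟨hA, hA'⟩ := fderiv_nabla hD hY hZ hx
  have hP := diff_perp (η := η) (hf.contDiffAt (hD.mem_nhds hx)) hA (hE x hx)
  have hT : nablaTflat η f Y Z = nablaFlat Y Z - perpPart (fun _ => η) f (nablaFlat Y Z) := rfl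
  have e1 : nablaTflat η f X (nablaTflat η f Y Z) x
      = nablaFlat X (nablaTflat η f Y Z) x
        - perpPart (fun _ => η) f (nablaFlat X (nablaTflat η f Y Z)) x := rfl
  have hW0 : ∀ y ∈ D, ∀ a, fderiv ℝ (fun y => f y a) y (W y) = 0 := by
    intro y hy a
    rw [← vact_eq]; exact hWt a y hy
  rw [e1, BB_sub_left, BB_perp hs hi f _ x _ (hW0 x hx), sub_zero,
    nablaFlat_eq (hT ▸ hA.sub hP), hT, fderiv_sub hA hP, ContinuousLinearMap.sub_apply,
    BB_sub_left, hA', sub_eq_add_neg]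
  congr 1
  have h0 : (fun y => BB η (perpPart (fun _ => η) f (nablaFlat Y Z) y) (W y))
      =ᶠ[nhds x] fun _ => 0 := by
    filter_upwards [hD.mem_nhds hx] with y hy
    exact BB_perp hs hi f _ y _ (hW0 y hy)
  have h1 := hasFDerivAt_BB η hP hWd (X x)
  rw [h0.fderiv_eq] at h1
  have h2 : BB η (perpPart (fun _ => η) f (nablaFlat Y Z) x)
      (nablaFlat X W x - IIflat η f X W x) = 0 := by
    refine BB_perp hs hi f _ x _ fun a => ?_
    rw [map_sub]
    unfold IIflat
    rw [fderiv_perp f _ x (hE x hx), sub_self]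
  rw [BB_sub_right, nablaFlat_eq hWd] at h2
  simp only [fderiv_fun_const, Pi.zero_apply, ContinuousLinearMap.zero_apply] at h1
  change _ = BB η (perpPart (fun _ => η) f (nablaFlat Y Z) x) (IIflat η f X W x)
  linarith

/-- **Gauss equation** for the flat ambient metric `η`: for tangent vector
fields `X, Y, Z, W`,
`η(R_t(X,Y)Z, W) = η(II(Y,Z), II(X,W)) − η(II(X,Z), II(Y,W))` on `D`. -/
theorem statement16 {n k : ℕ} (hk : 0 < k) (hkn : k < n)
    (D : Set (Fin n → ℝ)) (hD : IsOpen D)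
    (f : (Fin n → ℝ) → Fin k → ℝ) (hf : ContDiffOn ℝ (⊤ : ℕ∞) f D)
    (hrank : ∀ x ∈ D,
      (Matrix.of fun (a : Fin k) (i : Fin n) => pd (fun y => f y a) i x).rank = k)
    (η : Fin n → Fin n → ℝ) (hηsym : ∀ i j, η i j = η j i)
    (hηinv : IsUnit (Matrix.of η))
    (hE : ∀ x ∈ D, IsUnit (Matrix.of (Emat (fun _ => η) f x)))
    (X Y Z W : (Fin n → ℝ) → Fin n → ℝ)
    (hX : ContDiffOn ℝ (⊤ : ℕ∞) X D) (hY : ContDiffOn ℝ (⊤ : ℕ∞) Y D)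
    (hZ : ContDiffOn ℝ (⊤ : ℕ∞) Z D) (hW : ContDiffOn ℝ (⊤ : ℕ∞) W D)
    (hXt : ∀ a, ∀ x ∈ D, vact X (fun y => f y a) x = 0)
    (hYt : ∀ a, ∀ x ∈ D, vact Y (fun y => f y a) x = 0)
    (hZt : ∀ a, ∀ x ∈ D, vact Z (fun y => f y a) x = 0)
    (hWt : ∀ a, ∀ x ∈ D, vact W (fun y => f y a) x = 0) :
    ∀ x ∈ D,
      (∑ i, ∑ j, η i j * Rtflat η f X Y Z x i * W x j)
        = (∑ i, ∑ j, η i j * IIflat η f Y Z x i * IIflat η f X W x j)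
          - (∑ i, ∑ j, η i j * IIflat η f X Z x i * IIflat η f Y W x j) := by
  intro x hx
  have hXd : DifferentiableAt ℝ X x :=
    (hX.contDiffAt (hD.mem_nhds hx)).differentiableAt (by simp)
  have hYd : DifferentiableAt ℝ Y x :=
    (hY.contDiffAt (hD.mem_nhds hx)).differentiableAt (by simp)
  have hZx := hZ.contDiffAt (hD.mem_nhds hx)
  have hZd : DifferentiableAt ℝ Z x := hZx.differentiableAt (by simp)
  have hsymm : fderiv ℝ (fderiv ℝ Z) x (X x) (Y x) = fderiv ℝ (fderiv ℝ Z) x (Y x) (X x) :=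
    (hZx.isSymmSndFDerivAt (by simpa using two_le_smooth)) (X x) (Y x)
  have hR : Rtflat η f X Y Z x = nablaTflat η f X (nablaTflat η f Y Z) x
    - nablaTflat η f Y (nablaTflat η f X Z) x
    - nablaTflat η f (lie X Y) Z x := rfl
  have e1 : nablaTflat η f (lie X Y) Z x = nablaFlat (lie X Y) Z x
      - perpPart (fun _ => η) f (nablaFlat (lie X Y) Z) x := rfl
  have hW0 : ∀ a, fderiv ℝ (fun y => f y a) x (W x) = 0 := by
    intro a
    rw [← vact_eq]; exact hWt a x hx
  change BB η (Rtflat η f X Y Z x) (W x) = BB η (IIflat η f Y Z x) (IIflat η f X W x)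
    - BB η (IIflat η f X Z x) (IIflat η f Y W x)
  rw [hR, BB_sub_left, BB_sub_left, half hD hf hηsym hηinv hE hY hZ hW hWt hx,
    half hD hf hηsym hηinv hE hX hZ hW hWt hx, e1, BB_sub_left,
    BB_perp hηsym hηinv f _ x _ hW0, nablaFlat_eq hZd, lie_eq hXd hYd, hsymm, map_sub]
  have key : ∀ p q r : Fin n → ℝ, BB η (p + q) (W x) - BB η (p + r) (W x)
      = BB η (q - r) (W x) := by
    intro p q r
    rw [← BB_sub_left]; congr 1; abel
  have := key (fderiv ℝ (fderiv ℝ Z) x (Y x) (X x)) (fderiv ℝ Z x (fderiv ℝ Y x (X x)))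
    (fderiv ℝ Z x (fderiv ℝ X x (Y x)))
  linarith
end
end

section
/- For all indices i, j, h, k ∈ {1, …, n}, the Lie bracket of the vector fields L_{ij} satisfies the identity [L_{ij}, L_{hk}] = f_{jh} L_{ik} − f_{ih} L_{jk} − f_{jk} L_{ih} + f_{ik} L_{jh} as smooth vector fields on D, where f_{pq} = ∂_p ∂_q f denote the second partial derivatives of f (acting as multiplication by smooth functions). -/
open scoped BigOperators

noncomputable section

/-- The vector field `L_{ij} = f_i ∂_j − f_j ∂_i`. -/
def Lvf {n : ℕ} (f : (Fin n → ℝ) → ℝ) (i j : Fin n) (x : Fin n → ℝ) :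
    Fin n → ℝ :=
  fun m => pd f i x * (if m = j then 1 else 0) - pd f j x * (if m = i then 1 else 0)

/-- Pointwise derivative of the components of `Lvf`. -/
theorem pd_Lvf {n : ℕ} (f : (Fin n → ℝ) → ℝ) (x : Fin n → ℝ)
    (hd : ∀ p, DifferentiableAt ℝ (pd f p) x) (i j m k : Fin n) :
    pd (fun y => Lvf f i j y m) k x
      = pd (pd f i) k x * (if m = j then 1 else 0)
        - pd (pd f j) k x * (if m = i then 1 else 0) := by
  have h1 := ((hd i).hasFDerivAt.mul_const (if m = j then (1:ℝ) else 0)).sub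
    ((hd j).hasFDerivAt.mul_const (if m = i then (1:ℝ) else 0))
  have h2 : HasFDerivAt (fun y => Lvf f i j y m) _ x := h1
  unfold pd at h2 ⊢
  rw [h2.fderiv]
  split_ifs <;> simp

theorem pd_differentiableAt {n : ℕ} (f : (Fin n → ℝ) → ℝ) (x : Fin n → ℝ)
    (hf : ContDiffAt ℝ 2 f x) (p : Fin n) : DifferentiableAt ℝ (pd f p) x := by
  have h1 : DifferentiableAt ℝ (fderiv ℝ f) x :=
    (hf.fderiv_right (m := 1) (by norm_num)).differentiableAt (by norm_num)
  exact h1.clm_apply (differentiableAt_const _)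

theorem pd_pd_eq {n : ℕ} (f : (Fin n → ℝ) → ℝ) (x : Fin n → ℝ)
    (hf : ContDiffAt ℝ 2 f x) (p q : Fin n) :
    pd (pd f p) q x = fderiv ℝ (fderiv ℝ f) x (Pi.single q 1) (Pi.single p 1) := by
  have h1 : DifferentiableAt ℝ (fderiv ℝ f) x :=
    (hf.fderiv_right (m := 1) (by norm_num)).differentiableAt (by norm_num)
  have h2 : HasFDerivAt (pd f p) _ x :=
    h1.hasFDerivAt.clm_apply (hasFDerivAt_const (Pi.single p (1:ℝ) : Fin n → ℝ) x)
  rw [pd, h2.fderiv]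
  simp

theorem pd_pd_comm {n : ℕ} (f : (Fin n → ℝ) → ℝ) (x : Fin n → ℝ)
    (hf : ContDiffAt ℝ 2 f x) (p q : Fin n) :
    pd (pd f p) q x = pd (pd f q) p x := by
  rw [pd_pd_eq f x hf, pd_pd_eq f x hf]
  exact (hf.isSymmSndFDerivAt (by simp)).eq _ _

theorem sum_Lvf {n : ℕ} (f : (Fin n → ℝ) → ℝ) (x : Fin n → ℝ) (i j : Fin n)
    (g : Fin n → ℝ) : ∑ k, Lvf f i j x k * g k = pd f i x * g j - pd f j x * g i := by
  simp [Lvf, sub_mul, Finset.sum_sub_distrib]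

/-- The commutation relations
`[L_{ij}, L_{hl}] = f_{jh} L_{il} − f_{ih} L_{jl} − f_{jl} L_{ih} + f_{il} L_{jh}`
among the tangent vector fields `L_{ij}` on `D`, where `f_{pq} = ∂_p ∂_q f`. -/
theorem statement19 {n : ℕ}
    (D : Set (Fin n → ℝ)) (hD : IsOpen D)
    (f : (Fin n → ℝ) → ℝ) (hf : ContDiffOn ℝ (⊤ : ℕ∞) f D)
    (i j h l : Fin n) :
    ∀ x ∈ D, ∀ m,
      lie (Lvf f i j) (Lvf f h l) x m
        = pd (pd f h) j x * Lvf f i l x m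
          - pd (pd f h) i x * Lvf f j l x m
          - pd (pd f l) j x * Lvf f i h x m
          + pd (pd f l) i x * Lvf f j h x m := by
  intro x hx m
  have h2 : ContDiffAt ℝ 2 f x :=
    (hf.contDiffAt (hD.mem_nhds hx)).of_le (WithTop.coe_le_coe.mpr (le_top : (2 : ℕ∞) ≤ ⊤))
  have hd := pd_differentiableAt f x h2
  unfold lie
  rw [Finset.sum_sub_distrib, sum_Lvf, sum_Lvf]
  simp only [pd_Lvf f x hd]
  rw [pd_pd_comm f x h2 i h, pd_pd_comm f x h2 i l, pd_pd_comm f x h2 j h,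
    pd_pd_comm f x h2 j l]
  unfold Lvf
  ring
end
end
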